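/- Let G be a DAG on a finite node set V with disjoint node subsets X, Y and Z. If for every choice of nonempty finite value sets for the nodes and every joint probability distribution P that is Markov relative to G the conditional independence (X ⊥ Y | Z)_P holds, then X and Y are d-separated by Z in G. -/

import Mathlib

open scoped Classical

noncomputable section

/-- A directed graph (edge relation) is acyclic: no directed cycle, i.e. no node is
reachable from itself by a nonempty directed path.  (This implies irreflexivity.) -/
def IsAcyclic {V : Type} (E : V → V → Prop) : Prop :=
  ∀ v, ¬ Relation.TransGen E v v

/-- `m S`: the union of `S` with the set of all children of nodes of `S`. -/
def mSet {V : Type} (E : V → V → Prop) (S : Set V) : Set V :=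
  S ∪ {v | ∃ u ∈ S, E u v}

/-- `An S`: the union of `S` with the set of all ancestors of nodes of `S`. -/
def anc {V : Type} (E : V → V → Prop) (S : Set V) : Set V :=
  S ∪ {u | ∃ v ∈ S, Relation.TransGen E u v}

/-- A pseudo-path (relative to a set `W`) from `A` to `B`: a finite sequence of nodes
starting at `A` and ending at `B`, none of which lies in `W`, such that for each
consecutive pair `a, b` the set `m {a} ∩ m {b}` is not contained in `W`. -/
def IsPseudoPath {V : Type} (E : V → V → Prop) (W : Set V) (A B : V) (l : List V) : Prop :=
  l.head? = some A ∧ l.getLast? = some B ∧ (∀ v ∈ l, v ∉ W) ∧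
    l.Chain' (fun a b => ¬ (mSet E {a} ∩ mSet E {b} ⊆ W))

/-- `X` and `Y` are d-separated by `Z`: with `W = V \ An (X ∪ Y ∪ Z)`, every pseudo-path
from a node of `X` to a node of `Y` contains a node of `Z`. -/
def DSep {V : Type} (E : V → V → Prop) (X Y Z : Set V) : Prop :=
  ∀ A ∈ X, ∀ B ∈ Y, ∀ l : List V,
    IsPseudoPath E (Set.univ \ anc E (X ∪ Y ∪ Z)) A B l → ∃ v ∈ l, v ∈ Z

/-- `p` is a probability distribution on the finite type `α`. -/
def IsProbDist {α : Type} [Fintype α] (p : α → ℝ) : Prop :=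
  (∀ a, 0 ≤ p a) ∧ ∑ a, p a = 1

/-- The marginal probability, under the joint distribution `P`, of the value
assignment `x` on the set of nodes `S`. -/
noncomputable def margin {V : Type} [Fintype V] {Ω : V → Type} [∀ i, Fintype (Ω i)]
    (P : (∀ i, Ω i) → ℝ) (S : Set V) (x : ∀ i : S, Ω i) : ℝ :=
  ∑ g : ∀ i, Ω i, if ∀ i : S, g i = x i then P g else 0

/-- `P` is Markov relative to the directed graph `E`: there are stochastic kernels `k i`,
assigning to each value assignment on the parents of `i` a probability distribution on
`Ω i`, with `P g = ∏ i, k i (g restricted to pa i) (g i)` for every `g`. -/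
def IsMarkov {V : Type} [Fintype V] (E : V → V → Prop) (Ω : V → Type)
    [∀ i, Fintype (Ω i)] (P : (∀ i, Ω i) → ℝ) : Prop :=
  ∃ k : ∀ i : V, (∀ j : {j : V // E j i}, Ω j) → Ω i → ℝ,
    (∀ i pa x, 0 ≤ k i pa x) ∧
    (∀ i pa, ∑ x, k i pa x = 1) ∧
    (∀ g : ∀ i, Ω i, P g = ∏ i, k i (fun j => g j.1) (g i))

/-- Conditional independence `(X ⊥ Y | Z)_P`: for all value assignments on the
(disjoint) sets `X`, `Y`, `Z` we have `P(x,y,z)·P(z) = P(x,z)·P(y,z)`.  (Since all value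
sets are nonempty, quantifying over full assignments `g` and restricting is
equivalent.) -/
def CondIndep {V : Type} [Fintype V] {Ω : V → Type} [∀ i, Fintype (Ω i)]
    (P : (∀ i, Ω i) → ℝ) (X Y Z : Set V) : Prop :=
  ∀ g : ∀ i, Ω i,
    margin P (X ∪ Y ∪ Z) (fun i => g i) * margin P Z (fun i => g i) =
      margin P (X ∪ Z) (fun i => g i) * margin P (Y ∪ Z) (fun i => g i)

/-- Resampling one coordinate of a function multiplies the total sum by the number of values. -/
lemma sum_sum_update {V α : Type} [Fintype V] [Fintype α] (H : (V → α) → ℝ) (i : V) :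
    ∑ g : V → α, ∑ x : α, H (Function.update g i x) = (Fintype.card α : ℝ) * ∑ g, H g := by
  have hinv : Function.Involutive
      (fun q : (V → α) × α => (Function.update q.1 i q.2, q.1 i)) := by
    rintro ⟨g, x⟩
    simp
  have := Equiv.sum_comp hinv.toPerm (fun q : (V → α) × α => H q.1)
  rw [Fintype.sum_prod_type, Fintype.sum_prod_type] at this
  simpa [Finset.mul_sum] using this

lemma IsAcyclic.exists_sink {V : Type} [Fintype V] {E : V → V → Prop} (hE : IsAcyclic E)
    (S : Finset V) (hS : S.Nonempty) : ∃ i ∈ S, ∀ j ∈ S, ¬ E i j := by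
  have : Std.Irrefl (fun a b => Relation.TransGen E b a) := ⟨fun a => hE a⟩
  have : IsTrans V (fun a b => Relation.TransGen E b a) := ⟨fun _ _ _ h₁ h₂ => h₂.trans h₁⟩
  obtain ⟨i, hi, hmin⟩ :=
    (Finite.wellFounded_of_trans_of_irrefl (fun a b => Relation.TransGen E b a)).has_min
      (S : Set V) hS
  exact ⟨i, hi, fun j hj hij => hmin j hj (.single hij)⟩

/-- Summing a product of kernels over a subset of the nodes of a DAG. -/
lemma IsAcyclic.sum_prod_kernel {V α : Type} [Fintype V] [Fintype α] {E : V → V → Prop}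
    (hE : IsAcyclic E) (k : ∀ i : V, ({j : V // E j i} → α) → α → ℝ)
    (hk : ∀ i pa, ∑ x, k i pa x = 1) (S : Finset V) :
    (Fintype.card α : ℝ) ^ S.card * ∑ g : V → α, ∏ i ∈ S, k i (fun j => g j.1) (g i) =
      Fintype.card (V → α) := by
  induction hn : S.card generalizing S with
  | zero => simp [Finset.card_eq_zero.mp hn]
  | succ n ih =>
    obtain ⟨i, hi, hsink⟩ := hE.exists_sink S (Finset.card_pos.mp (by omega))
    rw [pow_succ, mul_assoc, ← sum_sum_update _ i,
      ← ih (S.erase i) (by rw [Finset.card_erase_of_mem hi]; omega)]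
    congr 1
    refine Finset.sum_congr rfl fun g _ => ?_
    have hfac : ∀ x, ∏ l ∈ S, k l (fun j => Function.update g i x j.1) (Function.update g i x l)
        = k i (fun j => g j.1) x * ∏ l ∈ S.erase i, k l (fun j => g j.1) (g l) := by
      intro x
      rw [← Finset.mul_prod_erase S _ hi]
      congr 1
      · rw [Function.update_self]
        congr 1
        funext j
        have hj : j.1 ≠ i := by
          intro h
          have hji := j.2
          rw [h] at hji
          exact hE i (.single hji)
        exact Function.update_of_ne hj _ _
      · refine Finset.prod_congr rfl fun l hl => ?_
        obtain ⟨hli, hlS⟩ := Finset.mem_erase.mp hl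
        rw [Function.update_of_ne hli]
        congr 1
        funext j
        exact Function.update_of_ne (fun h : j.1 = i => hsink l hlS (h ▸ j.2 : E i l)) _ _
    simp_rw [hfac]
    rw [← Finset.sum_mul, hk, one_mul]

/-- A product of kernels along a DAG is a probability distribution. -/
lemma IsAcyclic.isProbDist_prod_kernel {V α : Type} [Fintype V] [Fintype α] [Nonempty α]
    {E : V → V → Prop} (hE : IsAcyclic E) (k : ∀ i : V, ({j : V // E j i} → α) → α → ℝ)
    (hk0 : ∀ i pa x, 0 ≤ k i pa x) (hk : ∀ i pa, ∑ x, k i pa x = 1) :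
    IsProbDist (fun g : V → α => ∏ i, k i (fun j => g j.1) (g i)) := by
  refine ⟨fun g => Finset.prod_nonneg fun i _ => hk0 _ _ _, ?_⟩
  have h := hE.sum_prod_kernel k hk Finset.univ
  have hc : (Fintype.card α : ℝ) ^ (Finset.univ : Finset V).card ≠ 0 :=
    pow_ne_zero _ (Nat.cast_ne_zero.mpr Fintype.card_ne_zero)
  apply mul_left_cancel₀ hc
  rw [h]
  simp

/-- Every system of nonempty sets of admissible values is the support of some distribution
that is Markov relative to the DAG. -/
lemma IsAcyclic.exists_isMarkov_support {V α : Type} [Fintype V] [Fintype α] [Nonempty α]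
    {E : V → V → Prop} (hE : IsAcyclic E) (s : ∀ i : V, ({j : V // E j i} → α) → Finset α)
    (hs : ∀ i pa, (s i pa).Nonempty) :
    ∃ P : (V → α) → ℝ, IsProbDist P ∧ IsMarkov E (fun _ => α) P ∧
      ∀ g, P g ≠ 0 ↔ ∀ i, g i ∈ s i (fun j => g j.1) := by
  let k : ∀ i : V, ({j : V // E j i} → α) → α → ℝ := fun i pa x =>
    if x ∈ s i pa then ((s i pa).card : ℝ)⁻¹ else 0
  have hcard : ∀ i pa, ((s i pa).card : ℝ) ≠ 0 := fun i pa =>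
    Nat.cast_ne_zero.mpr (Finset.card_pos.mpr (hs i pa)).ne'
  have hk0 : ∀ i pa x, 0 ≤ k i pa x := by
    intro i pa x
    simp only [k]
    split_ifs <;> positivity
  have hk : ∀ i pa, ∑ x, k i pa x = 1 := by
    intro i pa
    simp [k, hcard]
  refine ⟨_, hE.isProbDist_prod_kernel k hk0 hk, ⟨k, hk0, hk, fun _ => rfl⟩, fun g => ?_⟩
  rw [Finset.prod_ne_zero_iff]
  refine ⟨fun h i => ?_, fun h i _ => ?_⟩
  · by_contra hc
    exact h i (Finset.mem_univ i) (if_neg hc)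
  · simpa [k, h i] using (hs i fun j => g j.1).ne_empty

lemma margin_pos {V : Type} [Fintype V] {Ω : V → Type} [∀ i, Fintype (Ω i)]
    {P : (∀ i, Ω i) → ℝ} (hP : ∀ g, 0 ≤ P g) (S : Set V) (g g' : ∀ i, Ω i)
    (hg' : P g' ≠ 0) (heq : ∀ i ∈ S, g' i = g i) : 0 < margin P S (fun i => g i) := by
  refine Finset.sum_pos' (fun a _ => ?_) ⟨g', Finset.mem_univ _, ?_⟩
  · split_ifs
    exacts [hP a, le_rfl]
  · rw [if_pos fun i : S => heq i i.2]
    exact (hP g').lt_of_ne' hg'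

/-- The value of node `j` when the bit `b` is broadcast to all nodes outside `Z`. -/
def broadcast {V : Type} (Z : Set V) (b : Bool) (j : V) : Option Bool :=
  some (if j ∈ Z then false else b)

/-- The local constraint at node `i`: either `i` signals a failure, or `i` and its parents
all carry the broadcast of one common bit. -/
def Consistent {V : Type} (E : V → V → Prop) (Z : Set V) (i : V)
    (pa : {j : V // E j i} → Option Bool) (x : Option Bool) : Prop :=
  x = none ∨ ∃ b, x = broadcast Z b i ∧ ∀ j, pa j = broadcast Z b j.1

lemma ne_none_of_mem_anc {V : Type} {E : V → V → Prop} {Z S : Set V} {g : V → Option Bool}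
    (hg : ∀ i, Consistent E Z i (fun j => g j.1) (g i)) (hS : ∀ i ∈ S, g i ≠ none)
    {c : V} (hc : c ∈ anc E S) : g c ≠ none := by
  have step : ∀ {a b : V}, E a b → g b ≠ none → g a ≠ none := by
    intro a b hab hb
    obtain h | ⟨β, -, h⟩ := hg b
    · exact absurd h hb
    · have := h ⟨a, hab⟩
      simp only at this
      simp [this, broadcast]
  obtain hc | ⟨v, hv, hcv⟩ := hc
  · exact hS c hc
  · induction hcv using Relation.TransGen.head_induction_on with
    | single h => exact step h (hS v hv)
    | head h _ ih => exact step h ih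

lemma eq_of_moral_edge {V : Type} {E : V → V → Prop} {Z S : Set V} {g : V → Option Bool}
    (hg : ∀ i, Consistent E Z i (fun j => g j.1) (g i)) (hS : ∀ i ∈ S, g i ≠ none)
    {a b : V} (ha : a ∉ Z) (hb : b ∉ Z)
    (hab : ¬ (mSet E {a} ∩ mSet E {b} ⊆ Set.univ \ anc E S)) : g a = g b := by
  obtain ⟨c, ⟨hca, hcb⟩, hc⟩ := Set.not_subset.mp hab
  have hc : c ∈ anc E S := by simpa using hc
  obtain h | ⟨β, hβ, hpa⟩ := hg c
  · exact absurd h (ne_none_of_mem_anc hg hS hc)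
  · have key : ∀ v, v ∉ Z → c ∈ mSet E {v} → g v = some β := by
      rintro v hv (hcv | ⟨u, hu, huc⟩)
      · obtain rfl : c = v := hcv
        simpa [broadcast, hv] using hβ
      · obtain rfl : u = v := hu
        simpa [broadcast, hv] using hpa ⟨u, huc⟩
    rw [key a ha hca, key b hb hcb]

lemma eq_of_isPseudoPath {V : Type} {E : V → V → Prop} {Z S : Set V} {g : V → Option Bool}
    (hg : ∀ i, Consistent E Z i (fun j => g j.1) (g i)) (hS : ∀ i ∈ S, g i ≠ none)
    {A B : V} {l : List V} (hl : IsPseudoPath E (Set.univ \ anc E S) A B l)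
    (hZ : ∀ v ∈ l, v ∉ Z) : g A = g B := by
  induction l generalizing A with
  | nil => simp [IsPseudoPath] at hl
  | cons a t ih =>
    obtain ⟨hA, hB, hW, hch⟩ := hl
    obtain rfl : a = A := by simpa using hA
    cases t with
    | nil =>
      obtain rfl : a = B := by simpa using hB
      rfl
    | cons b t =>
      obtain ⟨hab, hch⟩ := List.isChain_cons_cons.mp hch
      rw [eq_of_moral_edge hg hS (hZ a (by simp)) (hZ b (by simp)) hab]
      exact ih ⟨rfl, by simpa using hB, fun v hv => hW v (by simp [hv]), hch⟩
        fun v hv => hZ v (by simp [hv])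

/-- completeness of d-separation.  If for every choice of nonempty
finite value sets for the nodes and every joint probability distribution `P` that is
Markov relative to the DAG `G` the conditional independence `(X ⊥ Y | Z)_P` holds,
then `X` and `Y` are d-separated by `Z` in `G`. -/
theorem stmt2 {V : Type} [Fintype V] (E : V → V → Prop) (hE : IsAcyclic E)
    (X Y Z : Set V) (hXY : Disjoint X Y) (hXZ : Disjoint X Z) (hYZ : Disjoint Y Z)
    (h : ∀ (Ω : V → Type) [∀ i, Fintype (Ω i)] [∀ i, Nonempty (Ω i)]
      (P : (∀ i, Ω i) → ℝ), IsProbDist P → IsMarkov E Ω P → CondIndep P X Y Z) :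
    DSep E X Y Z := by
  intro A hA B hB l hl
  by_contra! hZ
  obtain ⟨P, hP, hM, hsupp⟩ := hE.exists_isMarkov_support
    (fun i pa => Finset.univ.filter (Consistent E Z i pa))
    (fun i pa => ⟨none, by simp [Consistent]⟩)
  simp only [Finset.mem_filter, Finset.mem_univ, true_and] at hsupp
  have hbroadcast : ∀ b, P (broadcast Z b) ≠ 0 := fun b =>
    (hsupp _).mpr fun i => .inr ⟨b, rfl, fun _ => rfl⟩
  let g : V → Option Bool := fun i => some (decide (i ∈ Y))
  have hXZ_pos : 0 < margin P (X ∪ Z) (fun i => g i) := by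
    refine margin_pos hP.1 _ _ _ (hbroadcast false) fun i hi => ?_
    have hiY : i ∉ Y := fun hY =>
      hi.elim (fun hX => Set.disjoint_left.mp hXY hX hY) (Set.disjoint_left.mp hYZ hY)
    simp [g, broadcast, hiY]
  have hYZ_pos : 0 < margin P (Y ∪ Z) (fun i => g i) := by
    refine margin_pos hP.1 _ _ _ (hbroadcast true) fun i hi => ?_
    obtain hi | hi := hi
    · simp [g, broadcast, hi, Set.disjoint_left.mp hYZ hi]
    · simp [g, broadcast, hi, Set.disjoint_right.mp hYZ hi]
  have hXYZ_zero : margin P (X ∪ Y ∪ Z) (fun i => g i) = 0 := by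
    refine Finset.sum_eq_zero fun g' _ => ?_
    split_ifs with hg'
    · by_contra hne
      have hval : ∀ i ∈ X ∪ Y ∪ Z, g' i = g i := fun i hi => hg' ⟨i, hi⟩
      have hAB := eq_of_isPseudoPath ((hsupp g').mp hne)
        (fun i hi => by simp [hval i hi, g]) hl hZ
      rw [hval A (by simp [hA]), hval B (by simp [hB])] at hAB
      simp [g, hB, Set.disjoint_left.mp hXY hA] at hAB
    · rfl
  have hCI := h (fun _ => Option Bool) P hP hM g
  rw [hXYZ_zero, zero_mul] at hCI
  exact (mul_pos hXZ_pos hYZ_pos).ne hCI
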